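/- Let Σ be a finite alphabet, φ : Σ* → Σ* a nonerasing morphism, and b ∈ Σ a letter such that φ(b) = γ₁ b δ₁ for finite words γ₁, δ₁, where the letter b does not occur in φ^m(γ₁) for any m ≥ 0 (in particular b does not occur in γ₁). Then b occurs in φ^l(b) for every l ≥ 0, and writing φ^l(b) = γ_l b δ_l where the displayed b is the leftmost occurrence of b in φ^l(b) (so γ₀ and δ₀ are empty), the following hold for every l ≥ 0: δ_{l+1} = δ₁·φ(δ_l); δ_l is a prefix of δ_{l+1}; and, if δ₁ is nonempty, |δ_{l+1}| > |δ_l|. -/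

import Mathlib

/-- Apply a morphism (given by its values on letters) to a finite word. -/
def substWord {A : Type*} (φ : A → List A) : List A → List A
  | [] => []
  | a :: w => φ a ++ substWord φ w

/-- The `n`-th iterate of a morphism applied to a word. -/
def iterWord {A : Type*} (φ : A → List A) (n : ℕ) (w : List A) : List A :=
  (substWord φ)^[n] w

theorem substWord_append {A : Type*} (φ : A → List A) (u v : List A) :
    substWord φ (u ++ v) = substWord φ u ++ substWord φ v := by
  induction u with
  | nil => rfl
  | cons a u ih => simp [substWord, ih]

theorem iterate_substWord_append {A : Type*} (φ : A → List A) (m : ℕ) (u v : List A) :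
    (substWord φ)^[m] (u ++ v) = (substWord φ)^[m] u ++ (substWord φ)^[m] v := by
  induction m generalizing u v with
  | zero => rfl
  | succ m ih => simp [Function.iterate_succ_apply, substWord_append, ih]

theorem length_le_length_substWord {A : Type*} {φ : A → List A} (hφ : ∀ c : A, φ c ≠ [])
    (w : List A) : w.length ≤ (substWord φ w).length := by
  induction w with
  | nil => exact le_rfl
  | cons a w ih =>
    have := List.length_pos_of_ne_nil (hφ a)
    simp only [substWord, List.length_cons, List.length_append]
    omega

theorem substWord_prefix {A : Type*} (φ : A → List A) {u v : List A} (h : u <+: v) :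
    substWord φ u <+: substWord φ v := by
  obtain ⟨t, rfl⟩ := h
  exact ⟨substWord φ t, (substWord_append φ u t).symm⟩

/-- The part of `φ^l(b)` to the left of the distinguished `b`, when `φ(b) = γ₁ b δ₁`. -/
def leftFactor {A : Type*} (φ : A → List A) (γ₁ : List A) : ℕ → List A
  | 0 => []
  | l + 1 => substWord φ (leftFactor φ γ₁ l) ++ γ₁

/-- The part of `φ^l(b)` to the right of the distinguished `b`, when `φ(b) = γ₁ b δ₁`. -/
def rightFactor {A : Type*} (φ : A → List A) (δ₁ : List A) : ℕ → List A
  | 0 => []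
  | l + 1 => δ₁ ++ substWord φ (rightFactor φ δ₁ l)

theorem iterWord_singleton_eq {A : Type*} {φ : A → List A} {b : A} {γ₁ δ₁ : List A}
    (hb : φ b = γ₁ ++ b :: δ₁) (l : ℕ) :
    iterWord φ l [b] = leftFactor φ γ₁ l ++ b :: rightFactor φ δ₁ l := by
  induction l with
  | zero => rfl
  | succ l ih =>
    unfold iterWord at ih ⊢
    rw [Function.iterate_succ_apply', ih, substWord_append]
    simp [substWord, hb, leftFactor, rightFactor]

theorem notMem_iterate_leftFactor {A : Type*} {φ : A → List A} {b : A} {γ₁ : List A}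
    (hγ₁ : ∀ m : ℕ, b ∉ (substWord φ)^[m] γ₁) (l m : ℕ) :
    b ∉ (substWord φ)^[m] (leftFactor φ γ₁ l) := by
  induction l generalizing m with
  | zero =>
    have h : (substWord φ)^[m] [] = [] := Function.iterate_fixed rfl m
    simp [leftFactor, h]
  | succ l ih =>
    rw [leftFactor, iterate_substWord_append, List.mem_append, not_or,
      ← Function.iterate_succ_apply]
    exact ⟨ih (m + 1), hγ₁ m⟩

theorem rightFactor_prefix_succ {A : Type*} (φ : A → List A) (δ₁ : List A) (l : ℕ) :
    rightFactor φ δ₁ l <+: rightFactor φ δ₁ (l + 1) := by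
  induction l with
  | zero => exact List.nil_prefix
  | succ l ih => exact (List.prefix_append_right_inj δ₁).2 (substWord_prefix φ ih)

/-- Suppose `φ(b) = γ₁ b δ₁` where `b` does not occur in `φ^m(γ₁)` for any
`m ≥ 0`. Then `b` occurs in each `φ^l(b)`, and writing
`φ^l(b) = γ_l b δ_l` with the displayed `b` the leftmost occurrence of `b`
(so `γ₀, δ₀` are empty), one has `δ_{l+1} = δ₁·φ(δ_l)`, `δ_l` is a prefix of
`δ_{l+1}`, and, if `δ₁` is nonempty, `|δ_{l+1}| > |δ_l|`. -/
theorem stmt18 {A : Type*} [Fintype A]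
    (φ : A → List A) (hφ : ∀ c : A, φ c ≠ [])
    (b : A) (γ₁ δ₁ : List A)
    (hb : φ b = γ₁ ++ b :: δ₁)
    (hγ₁ : ∀ m : ℕ, b ∉ (substWord φ)^[m] γ₁) :
    (∀ l : ℕ, b ∈ iterWord φ l [b]) ∧
    ∃ γs δs : ℕ → List A,
      γs 0 = [] ∧ δs 0 = [] ∧
      (∀ l : ℕ, iterWord φ l [b] = γs l ++ b :: δs l) ∧
      (∀ l : ℕ, b ∉ γs l) ∧
      (∀ l : ℕ, δs (l + 1) = δ₁ ++ substWord φ (δs l)) ∧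
      (∀ l : ℕ, δs l <+: δs (l + 1)) ∧
      (δ₁ ≠ [] → ∀ l : ℕ, (δs l).length < (δs (l + 1)).length) := by
  refine ⟨fun l => by simp [iterWord_singleton_eq hb], leftFactor φ γ₁, rightFactor φ δ₁,
    rfl, rfl, iterWord_singleton_eq hb, fun l => notMem_iterate_leftFactor hγ₁ l 0,
    fun l => rfl, rightFactor_prefix_succ φ δ₁, fun hδ₁ l => ?_⟩
  have hpos := List.length_pos_of_ne_nil hδ₁
  have hle := length_le_length_substWord hφ (rightFactor φ δ₁ l)
  rw [rightFactor, List.length_append]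
  omega
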